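/- arXiv:1510.07030 — 3 statements merged into one kernel-verified Lean document; each statement's English description precedes it below -/
import Mathlib

section
/- Suppose a risk measure ρ on L^∞(Ω,𝓕,P) has the Fatou property: ρ(X) ≤ liminf_n ρ(X_n) whenever (X_n) ⊂ L^∞ is uniformly bounded and converges a.s. to X ∈ L^∞. Then ρ is law invariant if and only if ρ admits a penalty function α : {Q ∈ 𝓟(Ω) : Q ≪ P} → [0,∞] (meaning ρ(X) = sup_{Q ≪ P}(E^Q[X] − α(Q)) for all X ∈ L^∞) satisfying α(Q∘T⁻¹) ≤ α(Q) for every Q ≪ P and every measurable T : Ω → Ω with P∘T⁻¹ = P. -/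
open MeasureTheory ProbabilityTheory Filter Topology
open scoped ENNReal NNReal

noncomputable section

namespace RiskDiv

/-- A bounded measurable real-valued function (a representative of an element of `L^∞`). -/
def BddMeas {E : Type*} [MeasurableSpace E] (f : E → ℝ) : Prop :=
  Measurable f ∧ ∃ M : ℝ, ∀ x, |f x| ≤ M

/-- A (normalized, convex, monotone, cash-additive) risk measure on `L^∞(E, μ)`,
viewed as a functional on bounded measurable functions which respects a.e. equality. -/
structure IsRiskMeasure {E : Type*} [MeasurableSpace E] (μ : Measure E)
    (ρ : (E → ℝ) → ℝ) : Prop where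
  mono : ∀ f g : E → ℝ, BddMeas f → BddMeas g → (∀ᵐ x ∂μ, f x ≤ g x) → ρ f ≤ ρ g
  cash : ∀ (f : E → ℝ) (c : ℝ), BddMeas f → ρ (fun x => f x + c) = ρ f + c
  norm0 : ρ (fun _ => 0) = 0
  cvx : ∀ (f g : E → ℝ) (t : ℝ), BddMeas f → BddMeas g → 0 ≤ t → t ≤ 1 →
    ρ (fun x => t * f x + (1 - t) * g x) ≤ t * ρ f + (1 - t) * ρ g
  congr_ae : ∀ f g : E → ℝ, BddMeas f → BddMeas g → (∀ᵐ x ∂μ, f x = g x) → ρ f = ρ g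

/-- Law invariance: `ρ` only depends on the distribution of its argument. -/
def LawInvariant {E : Type*} [MeasurableSpace E] (μ : Measure E) (ρ : (E → ℝ) → ℝ) : Prop :=
  ∀ f g : E → ℝ, BddMeas f → BddMeas g → μ.map f = μ.map g → ρ f = ρ g

open Classical in
/-- `ρ_μ(f) := ρ(f ∘ X)` where `X` is any random variable with law `μ` (this is well defined,
independently of the choice of `X`, when `ρ` is law invariant). -/
def rhoMu {Ω : Type*} [MeasurableSpace Ω] (P : Measure Ω) (ρ : (Ω → ℝ) → ℝ)
    {E : Type*} [MeasurableSpace E] (μ : Measure E) (f : E → ℝ) : ℝ :=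
  if h : ∃ X : Ω → E, Measurable X ∧ P.map X = μ then ρ (f ∘ h.choose) else 0

/-- The divergence induced by `ρ`:
`α(ν|μ) := sup { ∫ f dν − ρ_μ(f) : f bounded measurable } ∈ [0,∞]`. -/
def divergence {Ω : Type*} [MeasurableSpace Ω] (P : Measure Ω) (ρ : (Ω → ℝ) → ℝ)
    {E : Type*} [MeasurableSpace E] (ν μ : Measure E) : ℝ≥0∞ :=
  ⨆ (f : E → ℝ) (_ : BddMeas f), ENNReal.ofReal ((∫ x, f x ∂ν) - rhoMu P ρ μ f)

/-- The divergence induced by `ρ` is simplified if, on `[0,1]`, the supremum defining it can be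
restricted to continuous functions. -/
def Simplified {Ω : Type*} [MeasurableSpace Ω] (P : Measure Ω) (ρ : (Ω → ℝ) → ℝ) : Prop :=
  ∀ μ ν : Measure (Set.Icc (0:ℝ) 1), IsProbabilityMeasure μ → IsProbabilityMeasure ν →
    divergence P ρ ν μ =
      ⨆ (f : (Set.Icc (0:ℝ) 1) → ℝ) (_ : Continuous f),
        ENNReal.ofReal ((∫ x, f x ∂ν) - rhoMu P ρ μ f)


lemma exists_uniform {Ω : Type*} [MeasurableSpace Ω] [StandardBorelSpace Ω]
    (P : Measure Ω) [IsProbabilityMeasure P] [NullSingletonClass P] :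
    ∃ U : Ω → unitInterval, Measurable U ∧ P.map U = volume := by
  have he := measurableEmbedding_embeddingReal Ω
  set e := embeddingReal Ω with hedef
  set μ := P.map e with hμ
  have hμp : IsProbabilityMeasure μ := Measure.isProbabilityMeasure_map he.measurable.aemeasurable
  have hatom : ∀ x, μ {x} = 0 := by
    intro x
    rw [hμ, he.map_apply]
    refine Set.Subsingleton.measure_zero ?_ P
    intro a ha b hb
    exact he.injective (by simp at ha hb; rw [ha, hb])
  have hcont : Continuous (cdf μ) := by
    rw [continuous_iff_continuousAt]
    intro x
    have h1 := (cdf μ).measure_singleton x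
    rw [measure_cdf, hatom] at h1
    have h2 : cdf μ x ≤ Function.leftLim (cdf μ) x := by
      have := ENNReal.ofReal_eq_zero.1 h1.symm
      linarith
    have h3 : Function.leftLim (cdf μ) x = cdf μ x :=
      le_antisymm ((monotone_cdf μ).leftLim_le le_rfl) h2
    rw [continuousAt_iff_continuous_left_right]
    constructor
    · have h4 := (monotone_cdf μ).tendsto_leftLim x
      rw [h3] at h4
      exact continuousWithinAt_Iio_iff_Iic.1 h4
    · exact (cdf μ).right_continuous x
  have hivt : ∀ c : ℝ, 0 < c → c < 1 → ∃ b, cdf μ b = c := by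
    intro c h0 h1
    have := mem_range_of_exists_le_of_exists_ge hcont
      (((tendsto_cdf_atBot μ).eventually (ge_mem_nhds h0)).exists)
      (((tendsto_cdf_atTop μ).eventually (le_mem_nhds h1)).exists)
    exact this
  have hU : Measurable (fun ω => (⟨cdf μ (e ω), cdf_nonneg μ _, cdf_le_one μ _⟩ : unitInterval)) :=
    ((hcont.measurable).comp he.measurable).subtype_mk
  refine ⟨_, hU, ?_⟩
  have : IsProbabilityMeasure (P.map (fun ω => (⟨cdf μ (e ω), cdf_nonneg μ _, cdf_le_one μ _⟩ : unitInterval))) :=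
    Measure.isProbabilityMeasure_map hU.aemeasurable
  refine Measure.ext_of_Iic _ _ fun x => ?_
  rw [Measure.map_apply hU measurableSet_Iic]
  have hset : (fun ω => (⟨cdf μ (e ω), cdf_nonneg μ _, cdf_le_one μ _⟩ : unitInterval)) ⁻¹' Set.Iic x
      = e ⁻¹' {y | cdf μ y ≤ x} := by
    ext ω; simp [← Subtype.coe_le_coe]
  have hms : MeasurableSet {y | cdf μ y ≤ (x:ℝ)} := measurableSet_le hcont.measurable measurable_const
  rw [hset, ← Measure.map_apply he.measurable hms, ← hμ, unitInterval.volume_Iic]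
  obtain ⟨x, hx0, hx1⟩ := x
  simp only
  apply le_antisymm
  · refine ENNReal.le_of_forall_pos_le_add ?_
    intro ε hε _
    rw [← ENNReal.ofReal_coe_nnreal, ← ENNReal.ofReal_add hx0 ε.coe_nonneg]
    by_cases h : x + ε < 1
    · obtain ⟨b, hb⟩ := hivt (x + ε) (by have : (0:ℝ) < ε := hε; linarith) h
      rw [← hb, ofReal_cdf]
      refine measure_mono fun y hy => ?_
      simp only [Set.mem_ofPred_eq, Set.mem_Iic] at *
      by_contra hcon
      have := monotone_cdf μ (le_of_not_ge hcon)
      have h' : (0:ℝ) < ε := hε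
      linarith
    · refine prob_le_one.trans ?_
      rw [← ENNReal.ofReal_one]
      exact ENNReal.ofReal_le_ofReal (by linarith)
  · refine ENNReal.le_of_forall_pos_le_add ?_
    intro ε hε _
    have h' : (0:ℝ) < ε := hε
    by_cases h : 0 < x - ε
    · obtain ⟨b, hb⟩ := hivt (x - ε) h (by linarith)
      have h5 : ENNReal.ofReal x = ENNReal.ofReal (cdf μ b) + ε := by
        rw [← ENNReal.ofReal_coe_nnreal, ← ENNReal.ofReal_add (cdf_nonneg _ _) ε.coe_nonneg, hb]
        simp
      rw [h5, ofReal_cdf]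
      gcongr
      intro y hy
      have := monotone_cdf μ hy
      simp only [Set.mem_ofPred_eq]
      linarith
    · calc ENNReal.ofReal x ≤ ENNReal.ofReal ε := ENNReal.ofReal_le_ofReal (by linarith)
        _ = ε := ENNReal.ofReal_coe_nnreal
        _ ≤ _ := le_add_self

lemma exists_map {Ω : Type*} [MeasurableSpace Ω] [StandardBorelSpace Ω]
    (P : Measure Ω) [IsProbabilityMeasure P] [NullSingletonClass P]
    {E : Type*} [MeasurableSpace E] [StandardBorelSpace E] (ν : Measure E) [IsProbabilityMeasure ν] :
    ∃ S : Ω → E, Measurable S ∧ P.map S = ν := by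
  obtain ⟨U, hU, hU'⟩ := exists_uniform P
  have : Nonempty E := nonempty_of_isProbabilityMeasure ν
  obtain ⟨f, hf, hf'⟩ := ν.exists_measurable_map_eq
  refine ⟨f ∘ U, hf.comp hU, ?_⟩
  rw [← Measure.map_map hf hU, hU', hf']

lemma exists_glue {Ω : Type*} [MeasurableSpace Ω] [StandardBorelSpace Ω]
    (P : Measure Ω) [IsProbabilityMeasure P] [NullSingletonClass P]
    {E : Type*} [MeasurableSpace E] [StandardBorelSpace E]
    {ι : Type*} [Countable ι] [MeasurableSpace ι] [DiscreteMeasurableSpace ι]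
    (f : Ω → ι) (hf : Measurable f) (κ : ι → Measure E) (hκ : ∀ i, IsProbabilityMeasure (κ i)) :
    ∃ S : Ω → E, Measurable S ∧
      ∀ i B, MeasurableSet B → P (f ⁻¹' {i} ∩ S ⁻¹' B) = P (f ⁻¹' {i}) * κ i B := by
  have hex : ∀ i, ∃ S : Ω → E, Measurable S ∧
      ∀ B, MeasurableSet B → P (f ⁻¹' {i} ∩ S ⁻¹' B) = P (f ⁻¹' {i}) * κ i B := by
    intro i
    have hmi : MeasurableSet (f ⁻¹' {i}) := hf (measurableSet_singleton i)
    by_cases h : P (f ⁻¹' {i}) = 0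
    · obtain ⟨S, hS, -⟩ := exists_map P (κ i)
      refine ⟨S, hS, fun B _ => ?_⟩
      rw [h, zero_mul]
      exact measure_mono_null Set.inter_subset_left h
    · have : IsProbabilityMeasure (P[|f ⁻¹' {i}]) := cond_isProbabilityMeasure h
      have : NullSingletonClass (P[|f ⁻¹' {i}]) :=
        ⟨fun x => (cond_absolutelyContinuous (measure_singleton x))⟩
      obtain ⟨S, hS, hS'⟩ := exists_map (P[|f ⁻¹' {i}]) (κ i)
      refine ⟨S, hS, fun B hB => ?_⟩
      rw [← hS', Measure.map_apply hS hB, mul_comm, cond_mul_eq_inter hmi]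
  choose S hS hS' using hex
  refine ⟨fun ω => S (f ω) ω, ?_, ?_⟩
  · have : Measurable (fun p : ι × Ω => S p.1 p.2) := measurable_from_prod_countable_right hS
    exact this.comp (hf.prodMk measurable_id)
  · intro i B hB
    rw [← hS' i B hB]
    congr 1
    ext ω
    simp only [Set.mem_inter_iff, Set.mem_preimage, Set.mem_singleton_iff]
    constructor
    · rintro ⟨rfl, h⟩; exact ⟨rfl, h⟩
    · rintro ⟨rfl, h⟩; exact ⟨rfl, h⟩

lemma measure_fiber_sum {Ω : Type*} [MeasurableSpace Ω]
    (P : Measure Ω) {ι : Type*} [Countable ι] [MeasurableSpace ι] [DiscreteMeasurableSpace ι]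
    (f : Ω → ι) (hf : Measurable f) (B : Set Ω) (hB : MeasurableSet B) :
    P B = ∑' i, P (f ⁻¹' {i} ∩ B) := by
  rw [← measure_iUnion]
  · congr 1; ext ω; simp
  · intro i j hij
    refine Set.disjoint_left.2 ?_
    rintro ω ⟨h1, -⟩ ⟨h2, -⟩
    exact hij (h1.symm.trans h2)
  · intro i
    exact (hf (measurableSet_singleton i)).inter hB

lemma ae_of_fiber {Ω : Type*} [MeasurableSpace Ω]
    (P : Measure Ω) {ι : Type*} [Countable ι] 
    {E : Type*} [MeasurableSpace E] (f : Ω → ι) (S : Ω → E) (κ : ι → Measure E)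
    (h : ∀ i B, MeasurableSet B → P (f ⁻¹' {i} ∩ S ⁻¹' B) = P (f ⁻¹' {i}) * κ i B)
    (p : ι → E → Prop) (hp : ∀ i, P (f ⁻¹' {i}) ≠ 0 → ∀ᵐ y ∂(κ i), p i y) : ∀ᵐ ω ∂P, p (f ω) (S ω) := by
  rw [ae_iff]
  have : {ω | ¬ p (f ω) (S ω)} ⊆ ⋃ i, f ⁻¹' {i} ∩ S ⁻¹' (toMeasurable (κ i) {y | ¬ p i y}) := by
    intro ω hω
    rw [Set.mem_iUnion]
    exact ⟨f ω, rfl, subset_toMeasurable _ _ hω⟩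
  refine measure_mono_null this (measure_iUnion_null fun i => ?_)
  rw [h i _ (measurableSet_toMeasurable _ _), measure_toMeasurable]
  by_cases h0 : P (f ⁻¹' {i}) = 0
  · simp [h0]
  · rw [ae_iff.1 (hp i h0), mul_zero]

/-- conditional law on a cell -/
def cellLaw {Ω : Type*} [MeasurableSpace Ω] (P : Measure Ω) {ι : Type*} (f : Ω → ι) (i : ι) : Measure Ω :=
  open Classical in if P (f ⁻¹' {i}) = 0 then P else P[|f ⁻¹' {i}]

lemma cellLaw_prob {Ω : Type*} [MeasurableSpace Ω] (P : Measure Ω) [IsProbabilityMeasure P]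
    {ι : Type*} (f : Ω → ι) (i : ι) : IsProbabilityMeasure (cellLaw P f i) := by
  unfold cellLaw
  split_ifs with h
  · infer_instance
  · exact cond_isProbabilityMeasure h

lemma cellLaw_ac {Ω : Type*} [MeasurableSpace Ω] (P : Measure Ω) 
    {ι : Type*} (f : Ω → ι) (i : ι) : cellLaw P f i ≪ P := by
  unfold cellLaw
  split_ifs with h
  · exact Measure.AbsolutelyContinuous.rfl
  · exact cond_absolutelyContinuous

lemma cellLaw_mul {Ω : Type*} [MeasurableSpace Ω] (P : Measure Ω) [IsProbabilityMeasure P]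
    {ι : Type*} (f : Ω → ι) (i : ι) (hi : MeasurableSet (f ⁻¹' {i})) (B : Set Ω) :
    P (f ⁻¹' {i}) * cellLaw P f i B = P (f ⁻¹' {i} ∩ B) := by
  unfold cellLaw
  split_ifs with h
  · rw [h, zero_mul, measure_mono_null Set.inter_subset_left h]
  · rw [mul_comm, cond_mul_eq_inter hi]

section B
variable {Ω : Type*} [MeasurableSpace Ω]

lemma BddMeas.integrable {X : Ω → ℝ} (hX : BddMeas X) (Q : Measure Ω) [IsFiniteMeasure Q] :
    Integrable X Q := by
  obtain ⟨hm, M, hM⟩ := hX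
  exact Integrable.of_bound hm.aestronglyMeasurable M (ae_of_all _ fun x => by simpa using hM x)

/-- Discretised transport. -/
lemma exists_transport [StandardBorelSpace Ω]
    (P : Measure Ω) [IsProbabilityMeasure P] [NullSingletonClass P]
    {ι : Type*} [Countable ι] [MeasurableSpace ι] [DiscreteMeasurableSpace ι]
    (f g : Ω → ι) (hf : Measurable f) (hg : Measurable g) (h : P.map f = P.map g) :
    ∃ T : Ω → Ω, Measurable T ∧ P.map T = P ∧ ∀ᵐ ω ∂P, g (T ω) = f ω := by
  obtain ⟨T, hT, hT'⟩ := exists_glue P f hf (cellLaw P g) (cellLaw_prob P g)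
  have hfg : ∀ i, P (f ⁻¹' {i}) = P (g ⁻¹' {i}) := by
    intro i
    rw [← Measure.map_apply hf (measurableSet_singleton i), h,
      Measure.map_apply hg (measurableSet_singleton i)]
  refine ⟨T, hT, ?_, ?_⟩
  · ext B hB
    rw [Measure.map_apply hT hB, measure_fiber_sum P f hf _ (hT hB), measure_fiber_sum P g hg B hB]
    refine tsum_congr fun i => ?_
    rw [hT' i B hB, hfg, cellLaw_mul P g i (hg (measurableSet_singleton i))]
  · refine ae_of_fiber P f T (cellLaw P g) hT' (fun i y => g y = i) fun i hi => ?_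
    rw [ae_iff]
    have h0 := cellLaw_mul P g i (hg (measurableSet_singleton i)) {y | ¬ g y = i}
    have h1 : g ⁻¹' {i} ∩ {y | ¬ g y = i} = ∅ := by
      ext y; simp
    rw [h1, measure_empty, mul_eq_zero, ← hfg] at h0
    exact h0.resolve_left hi

lemma backward_le [StandardBorelSpace Ω]
    (P : Measure Ω) [IsProbabilityMeasure P] [NullSingletonClass P]
    (ρ : (Ω → ℝ) → ℝ) (α : Measure Ω → ℝ≥0∞)
    (hrep : ∀ X : Ω → ℝ, BddMeas X →
          (ρ X : EReal) =
            ⨆ (Q : Measure Ω) (_ : IsProbabilityMeasure Q) (_ : Q ≪ P),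
              (((∫ ω, X ω ∂Q : ℝ) : EReal) - ((α Q : ℝ≥0∞) : EReal)))
    (hα : ∀ Q : Measure Ω, IsProbabilityMeasure Q → Q ≪ P →
          ∀ T : Ω → Ω, Measurable T → P.map T = P → α (Q.map T) ≤ α Q)
    (X Y : Ω → ℝ) (hX : BddMeas X) (hY : BddMeas Y) (hXY : P.map X = P.map Y) :
    ρ X ≤ ρ Y := by
  refine le_of_forall_pos_le_add fun ε hε => ?_
  have hφ : Measurable (fun x : ℝ => ⌊x / ε⌋) := Int.measurable_floor.comp (measurable_id.div_const ε)
  obtain ⟨T, hT, hTP, hgT⟩ := exists_transport P (fun ω => ⌊X ω / ε⌋) (fun ω => ⌊Y ω / ε⌋)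
    (hφ.comp hX.1) (hφ.comp hY.1) (by
      have h1 := Measure.map_map (μ := P) hφ hX.1
      have h2 := Measure.map_map (μ := P) hφ hY.1
      rw [hXY] at h1
      exact h1.symm.trans h2)
  have hclose : ∀ᵐ ω ∂P, X ω ≤ Y (T ω) + ε := by
    filter_upwards [hgT] with ω hω
    have h1 := Int.lt_floor_add_one (X ω / ε)
    have h2 := Int.floor_le (Y (T ω) / ε)
    rw [hω] at h2
    have : X ω / ε < Y (T ω) / ε + 1 := by linarith
    rw [div_lt_iff₀ hε, add_mul, div_mul_cancel₀ _ hε.ne'] at this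
    linarith
  rw [← EReal.coe_le_coe_iff, hrep X hX]
  refine iSup_le fun Q => iSup_le fun hQ => iSup_le fun hQP => ?_
  have hQT : IsProbabilityMeasure (Q.map T) := Measure.isProbabilityMeasure_map hT.aemeasurable
  have hQTP : Q.map T ≪ P := by
    have := hQP.map hT
    rwa [hTP] at this
  have h1 : (((∫ ω, Y ω ∂(Q.map T) : ℝ) : EReal) - ((α (Q.map T) : ℝ≥0∞) : EReal)) ≤ (ρ Y : EReal) := by
    rw [hrep Y hY]
    exact le_iSup_of_le (Q.map T) (le_iSup_of_le hQT (le_iSup_of_le hQTP le_rfl))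
  have hYT : BddMeas (fun ω => Y (T ω)) := ⟨hY.1.comp hT, hY.2.imp fun M hM x => hM _⟩
  have h2 : ∫ ω, X ω ∂Q ≤ ∫ ω, Y ω ∂(Q.map T) + ε := by
    rw [integral_map hT.aemeasurable hY.1.aestronglyMeasurable]
    calc ∫ ω, X ω ∂Q ≤ ∫ ω, (Y (T ω) + ε) ∂Q :=
          integral_mono_ae (hX.integrable Q) ((hYT.integrable Q).add (integrable_const _))
            (hQP.ae_le hclose)
      _ = _ := by
          rw [integral_add (hYT.integrable Q) (integrable_const _)]; simp
  have h3 := hα Q hQ hQP T hT hTP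
  calc (((∫ ω, X ω ∂Q : ℝ) : EReal) - ((α Q : ℝ≥0∞) : EReal))
      ≤ ((∫ ω, Y ω ∂(Q.map T) + ε : ℝ) : EReal) - ((α (Q.map T) : ℝ≥0∞) : EReal) :=
        EReal.sub_le_sub (EReal.coe_le_coe_iff.2 h2) (by exact_mod_cast h3)
    _ = (((∫ ω, Y ω ∂(Q.map T) : ℝ) : EReal) - ((α (Q.map T) : ℝ≥0∞) : EReal)) + (ε : EReal) := by
        rw [EReal.coe_add, sub_eq_add_neg, sub_eq_add_neg, add_right_comm]
    _ ≤ (ρ Y : EReal) + (ε : EReal) := by gcongr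
    _ = _ := by rw [EReal.coe_add]

lemma IsRiskMeasure.const {P : Measure Ω} {ρ : (Ω → ℝ) → ℝ} (hρ : IsRiskMeasure P ρ) (c : ℝ) :
    ρ (fun _ => c) = c := by
  have := hρ.cash (fun _ => 0) c ⟨measurable_const, 0, by simp⟩
  simpa [hρ.norm0] using this

lemma IsRiskMeasure.avg_le {P : Measure Ω} {ρ : (Ω → ℝ) → ℝ} (hρ : IsRiskMeasure P ρ)
    (Y : ℕ → Ω → ℝ) (hY : ∀ k, Measurable (Y k)) (M : ℝ) (hM : ∀ k ω, |Y k ω| ≤ M)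
    (c : ℝ) (hc : ∀ k, ρ (Y k) ≤ c) (n : ℕ) :
    BddMeas (fun ω => (∑ k ∈ Finset.range (n + 1), Y k ω) / ((n + 1 : ℕ) : ℝ)) ∧
    (∀ ω, |(∑ k ∈ Finset.range (n + 1), Y k ω) / ((n + 1 : ℕ) : ℝ)| ≤ M) ∧
    ρ (fun ω => (∑ k ∈ Finset.range (n + 1), Y k ω) / ((n + 1 : ℕ) : ℝ)) ≤ c := by
  have hb : ∀ n : ℕ, ∀ ω, |(∑ k ∈ Finset.range (n + 1), Y k ω) / ((n + 1 : ℕ) : ℝ)| ≤ M := by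
    intro n ω
    have hpos : (0 : ℝ) < ((n + 1 : ℕ) : ℝ) := by positivity
    rw [abs_div, abs_of_pos hpos, div_le_iff₀ hpos]
    refine (Finset.abs_sum_le_sum_abs _ _).trans ?_
    refine (Finset.sum_le_sum fun k _ => hM k ω).trans ?_
    simp [mul_comm]
  have hbm : ∀ n : ℕ, BddMeas (fun ω => (∑ k ∈ Finset.range (n + 1), Y k ω) / ((n + 1 : ℕ) : ℝ)) := by
    intro n
    exact ⟨(Finset.measurable_fun_sum _ fun k _ => hY k).div_const _, M, hb n⟩
  refine ⟨hbm n, hb n, ?_⟩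
  induction n with
  | zero => simpa using hc 0
  | succ n ih =>
    have h1 : ((n + 1 : ℕ) : ℝ) / ((n + 1 + 1 : ℕ) : ℝ) ≤ 1 := by
      rw [div_le_one (by positivity)]; push_cast; linarith
    have h0 : (0 : ℝ) ≤ ((n + 1 : ℕ) : ℝ) / ((n + 1 + 1 : ℕ) : ℝ) := by positivity
    have := hρ.cvx _ (Y (n + 1)) (((n + 1 : ℕ) : ℝ) / ((n + 1 + 1 : ℕ) : ℝ)) (hbm n)
      ⟨hY _, M, hM _⟩ h0 h1
    have heq : (fun ω => (∑ k ∈ Finset.range (n + 1 + 1), Y k ω) / ((n + 1 + 1 : ℕ) : ℝ)) =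
      (fun ω => ((n + 1 : ℕ) : ℝ) / ((n + 1 + 1 : ℕ) : ℝ) *
        ((∑ k ∈ Finset.range (n + 1), Y k ω) / ((n + 1 : ℕ) : ℝ)) +
        (1 - ((n + 1 : ℕ) : ℝ) / ((n + 1 + 1 : ℕ) : ℝ)) * Y (n + 1) ω) := by
      funext ω
      rw [Finset.sum_range_succ _ (n + 1)]
      push_cast
      field_simp
      ring
    rw [heq]
    refine this.trans ?_
    have h2 := mul_le_mul_of_nonneg_left ih h0
    have h3 := mul_le_mul_of_nonneg_left (hc (n + 1)) (sub_nonneg.2 h1)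
    linarith

lemma le_of_le_liminf (u : ℕ → ℝ) (a c m : ℝ) (h : a ≤ liminf u atTop) (hc : ∀ n, u n ≤ c)
    (hm : ∀ n, m ≤ u n) : a ≤ c := by
  refine h.trans ?_
  by_contra! hcon
  have := eventually_lt_of_lt_liminf hcon ⟨m, by simpa using ⟨0, fun n _ => hm n⟩⟩
  obtain ⟨n, hn⟩ := this.exists
  exact absurd (hc n) (not_le.2 hn)

/-- Averaging over the cells of a countable partition decreases the risk. -/
lemma cellAverage_le [StandardBorelSpace Ω]
    (P : Measure Ω) [IsProbabilityMeasure P] [NullSingletonClass P]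
    (ρ : (Ω → ℝ) → ℝ) (hρ : IsRiskMeasure P ρ)
    (hFatou : ∀ (Xn : ℕ → Ω → ℝ) (X : Ω → ℝ) (M : ℝ), (∀ n, Measurable (Xn n)) →
      Measurable X → (∀ n ω, |Xn n ω| ≤ M) →
      (∀ᵐ ω ∂P, Tendsto (fun n => Xn n ω) atTop (𝓝 (X ω))) →
      ρ X ≤ liminf (fun n => ρ (Xn n)) atTop)
    (hlaw : LawInvariant P ρ)
    {ι : Type*} [Countable ι] [MeasurableSpace ι] [DiscreteMeasurableSpace ι]
    (f : Ω → ι) (hf : Measurable f) (X : Ω → ℝ) (hX : BddMeas X) :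
    ρ (fun ω => ∫ x, X x ∂(cellLaw P f (f ω))) ≤ ρ X := by
  have hcp := cellLaw_prob P f
  obtain ⟨S, hS, hS'⟩ := exists_glue P f hf
    (fun i => Measure.infinitePi (fun _ : ℕ => cellLaw P f i)) (fun i => inferInstance)
  obtain ⟨hXm, M, hM⟩ := id hX
  set Y : ℕ → Ω → ℝ := fun k ω => X (S ω k) with hYdef
  have hSk : ∀ k, Measurable (fun ω => S ω k) := fun k => (measurable_pi_apply k).comp hS
  have hYm : ∀ k, Measurable (Y k) := fun k => hXm.comp (hSk k)
  have hYb : ∀ k ω, |Y k ω| ≤ M := fun k ω => hM _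
  have hSP : ∀ k, P.map (fun ω => S ω k) = P := by
    intro k
    ext B hB
    rw [Measure.map_apply (hSk k) hB, measure_fiber_sum P f hf _ (hSk k hB),
      measure_fiber_sum P f hf B hB]
    refine tsum_congr fun i => ?_
    have h1 := hS' i ((fun s => s k) ⁻¹' B) (measurable_pi_apply k hB)
    rw [← cellLaw_mul P f i (hf (measurableSet_singleton i)) B]
    refine h1.trans ?_
    congr 1
    have := Measure.infinitePi_map_eval (fun _ : ℕ => cellLaw P f i) k
    conv_rhs => rw [← this]
    rw [Measure.map_apply (measurable_pi_apply k) hB]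
  have hYρ : ∀ k, ρ (Y k) ≤ ρ X := by
    intro k
    refine le_of_eq (hlaw _ _ ⟨hYm k, M, hYb k⟩ hX ?_)
    have := Measure.map_map (μ := P) hXm (hSk k)
    rw [hSP] at this
    exact this.symm
  have hconv : ∀ᵐ ω ∂P, Tendsto (fun n : ℕ => (∑ k ∈ Finset.range n, Y k ω) / (n : ℝ)) atTop
      (𝓝 (∫ x, X x ∂(cellLaw P f (f ω)))) := by
    refine ae_of_fiber P f S _ hS'
      (fun i s => Tendsto (fun n : ℕ => (∑ k ∈ Finset.range n, X (s k)) / (n : ℝ)) atTop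
      (𝓝 (∫ x, X x ∂(cellLaw P f i)))) fun i _ => ?_
    have hmap : ∀ k, (Measure.infinitePi (fun _ : ℕ => cellLaw P f i)).map (fun s => s k) = cellLaw P f i :=
      fun k => Measure.infinitePi_map_eval (fun _ : ℕ => cellLaw P f i) k
    have hmap' : ∀ k, (Measure.infinitePi (fun _ : ℕ => cellLaw P f i)).map (fun s => X (s k)) =
        (cellLaw P f i).map X := by
      intro k
      have := Measure.map_map (μ := Measure.infinitePi (fun _ : ℕ => cellLaw P f i)) hXm
        (measurable_pi_apply k)
      rw [hmap] at this
      exact this.symm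
    have hXk : ∀ k, Measurable (fun s : ℕ → Ω => X (s k)) := fun k => hXm.comp (measurable_pi_apply k)
    have hind : iIndepFun (fun (k : ℕ) (s : ℕ → Ω) => X (s k))
        (Measure.infinitePi (fun _ : ℕ => cellLaw P f i)) :=
      iIndepFun_infinitePi (P := fun _ : ℕ => cellLaw P f i) (X := fun _ => X) (fun _ => hXm)
    have := strong_law_ae_real (μ := Measure.infinitePi (fun _ : ℕ => cellLaw P f i))
      (fun k s => X (s k)) (BddMeas.integrable ⟨hXk 0, M, fun s => hM _⟩ _)
      (fun a b hab => hind.indepFun hab)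
      (fun k => ⟨(hXk k).aemeasurable, (hXk 0).aemeasurable, by rw [hmap', hmap']⟩)
    have hint : ∫ s : ℕ → Ω, X (s 0) ∂(Measure.infinitePi (fun _ : ℕ => cellLaw P f i)) =
        ∫ x, X x ∂(cellLaw P f i) := by
      conv_rhs => rw [← hmap 0]
      rw [integral_map (measurable_pi_apply 0).aemeasurable hXm.aestronglyMeasurable]
    rw [hint] at this
    exact this
  have hav := fun n => hρ.avg_le Y hYm M hYb (ρ X) hYρ n
  have hZ : Measurable (fun ω => ∫ x, X x ∂(cellLaw P f (f ω))) :=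
    (measurable_of_countable (fun i => ∫ x, X x ∂(cellLaw P f i))).comp hf
  refine le_of_le_liminf _ _ _ (-M) (hFatou _ _ M (fun n => (hav n).1.1) hZ (fun n => (hav n).2.1) ?_)
    (fun n => (hav n).2.2) fun n => ?_
  · filter_upwards [hconv] with ω hω
    exact (tendsto_add_atTop_iff_nat (f := fun n : ℕ => (∑ k ∈ Finset.range n, Y k ω) / (n : ℝ)) 1).2 hω
  · rw [← hρ.const (-M)]
    exact hρ.mono _ _ ⟨measurable_const, |(-M)|, fun _ => le_rfl⟩ (hav n).1
      (ae_of_all _ fun ω => (abs_le.1 ((hav n).2.1 ω)).1)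

end B

section C
variable {Ω : Type*} [MeasurableSpace Ω]

/-- The minimal penalty function. -/
def minPenalty (ρ : (Ω → ℝ) → ℝ) (Q : Measure Ω) : ℝ≥0∞ :=
  ⨆ (X : Ω → ℝ) (_ : BddMeas X), ENNReal.ofReal ((∫ ω, X ω ∂Q) - ρ X)

/-- Finite dimensional duality. -/
lemma exists_dual (P : Measure Ω) [IsProbabilityMeasure P]
    (ρ : (Ω → ℝ) → ℝ) (hρ : IsRiskMeasure P ρ)
    {ι : Type*} [Finite ι] [MeasurableSpace ι] [DiscreteMeasurableSpace ι]
    (f : Ω → ι) (hf : Measurable f)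
    (havg : ∀ X : Ω → ℝ, BddMeas X → ρ (fun ω => ∫ x, X x ∂(cellLaw P f (f ω))) ≤ ρ X)
    (X : Ω → ℝ) (hX : BddMeas X) (a : ℝ)
    (ha : a < ρ (fun ω => ∫ x, X x ∂(cellLaw P f (f ω)))) :
    ∃ Q : Measure Ω, IsProbabilityMeasure Q ∧ Q ≪ P ∧
      (a : EReal) ≤ ((∫ ω, X ω ∂Q : ℝ) : EReal) - (minPenalty ρ Q : EReal) := by
  classical
  have := Fintype.ofFinite ι
  have hcp := cellLaw_prob P f
  set r : (ι → ℝ) → ℝ := fun v => ρ (fun ω => v (f ω)) with hr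
  have hbm : ∀ v : ι → ℝ, BddMeas (fun ω => v (f ω)) := by
    intro v
    refine ⟨(measurable_of_countable v).comp hf, ‖v‖, fun ω => ?_⟩
    exact norm_le_pi_norm v (f ω)
  have hcvx : ConvexOn ℝ Set.univ r := by
    refine ⟨convex_univ, fun v _ w _ s t hs ht hst => ?_⟩
    have h := hρ.cvx _ _ s (hbm v) (hbm w) hs (by linarith)
    have ht' : 1 - s = t := by linarith
    rw [ht'] at h
    exact h
  have hmono : ∀ v w : ι → ℝ, (∀ i, v i ≤ w i) → r v ≤ r w := fun v w h =>
    hρ.mono _ _ (hbm v) (hbm w) (ae_of_all _ fun ω => h _)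
  have hcash : ∀ (v : ι → ℝ) (c : ℝ), r (fun i => v i + c) = r v + c := fun v c =>
    hρ.cash _ c (hbm v)
  have hr0 : ∀ c : ℝ, r (fun _ => c) = c := fun c => hρ.const c
  have hcont : Continuous r := by
    refine (LipschitzWith.of_le_add fun v w => ?_).continuous
    rw [← hcash]
    refine hmono v (fun i => w i + dist v w) fun i => ?_
    have h1 := dist_le_pi_dist v w i
    have h2 := (abs_le.1 (Real.dist_eq (v i) (w i) ▸ h1)).2
    linarith
  obtain ⟨l, c, hle, hlx⟩ := hcvx.exists_affine_le_of_lt (𝕜 := ℝ)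
    (x := fun i => ∫ x, X x ∂(cellLaw P f i)) (Set.mem_univ _) ha isClosed_univ
    (hcont.lowerSemicontinuous.lowerSemicontinuousOn _)
  have hle' : ∀ v, l v + c ≤ r v := fun v => hle ⟨v, Set.mem_univ _⟩
  have hlx' : l (fun i => ∫ x, X x ∂(cellLaw P f i)) + c = a := hlx
  -- weights
  set q : ι → ℝ := fun i => l (Pi.single i 1) with hq
  have hlq : ∀ v, l v = ∑ i, q i * v i := by
    intro v
    have := LinearMap.pi_apply_eq_sum_univ (l : (ι → ℝ) →ₗ[ℝ] ℝ) v
    simp only [ContinuousLinearMap.coe_coe, smul_eq_mul] at this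
    rw [this]
    refine Finset.sum_congr rfl fun i _ => ?_
    rw [mul_comm, hq]
    congr 2
    ext j
    simp [Pi.single_apply, eq_comm]
  have hc0 : c ≤ 0 := by
    have := hle' 0
    have h2 := hr0 0
    rw [map_zero, zero_add] at this
    exact this.trans_eq h2
  have hq0 : ∀ i, 0 ≤ q i := by
    intro i
    by_contra! hneg
    have h1 : ∀ t : ℝ, 0 ≤ t → -(t * q i) + c ≤ 0 := by
      intro t ht
      have h2 := hle' (-(t • Pi.single i 1))
      rw [map_neg, map_smul, smul_eq_mul] at h2
      refine h2.trans ?_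
      refine (hmono _ (fun _ => 0) fun j => ?_).trans_eq (hr0 0)
      simp only [Pi.neg_apply, Pi.smul_apply, smul_eq_mul, Pi.single_apply]
      split_ifs <;> simp [ht]
    have h3 := h1 ((1 - c) / (-q i)) (div_nonneg (by linarith) (by linarith))
    have h4 : (1 - c) / (-q i) * q i = -(1 - c) := by
      have := hneg.ne
      rw [div_neg, neg_mul, div_mul_cancel₀ _ this]
    rw [h4] at h3
    linarith
  have hq1 : ∑ i, q i = 1 := by
    have h1 : ∀ t : ℝ, t * (∑ i, q i) + c ≤ t := by
      intro t
      have h2 := hle' (fun _ => t)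
      rw [hr0, hlq, ← Finset.sum_mul, mul_comm] at h2
      exact h2
    by_contra hne
    have hne' : (∑ i, q i) - 1 ≠ 0 := sub_ne_zero.2 hne
    have h3 := h1 ((1 - c) / ((∑ i, q i) - 1))
    have h4 : (1 - c) / ((∑ i, q i) - 1) * (∑ i, q i) = (1 - c) / ((∑ i, q i) - 1) + (1 - c) := by
      field_simp
      ring
    rw [h4] at h3
    linarith
  set Q : Measure Ω := ∑ i, ENNReal.ofReal (q i) • cellLaw P f i with hQ
  have hQprob : IsProbabilityMeasure Q := by
    constructor
    rw [hQ, Measure.finsetSum_apply]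
    simp only [Measure.smul_apply, measure_univ, smul_eq_mul, mul_one]
    rw [← ENNReal.ofReal_sum_of_nonneg fun i _ => hq0 i, hq1, ENNReal.ofReal_one]
  have hQint : ∀ X : Ω → ℝ, BddMeas X → ∫ ω, X ω ∂Q = l (fun i => ∫ x, X x ∂(cellLaw P f i)) := by
    intro X hX
    rw [hlq, hQ, integral_finsetSum_measure]
    · refine Finset.sum_congr rfl fun i _ => ?_
      rw [integral_smul_measure, ENNReal.toReal_ofReal (hq0 i), smul_eq_mul]
    · intro i _
      exact (hX.integrable _).smul_measure ENNReal.ofReal_ne_top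
  have hpen : minPenalty ρ Q ≤ ENNReal.ofReal (-c) := by
    refine iSup_le fun X' => iSup_le fun hX' => ENNReal.ofReal_le_ofReal ?_
    rw [hQint X' hX']
    have h1 := hle' (fun i => ∫ x, X' x ∂(cellLaw P f i))
    have h2 := havg X' hX'
    simp only [hr] at h1
    linarith
  refine ⟨Q, hQprob, ?_, ?_⟩
  · intro s hs
    rw [hQ, Measure.finsetSum_apply]
    refine Finset.sum_eq_zero fun i _ => ?_
    rw [Measure.smul_apply, cellLaw_ac P f i hs, smul_zero]
  · calc (a : EReal) = ((∫ ω, X ω ∂Q : ℝ) : EReal) - ((-c : ℝ) : EReal) := by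
          rw [hQint X hX, ← EReal.coe_sub, sub_neg_eq_add, hlx']
      _ ≤ _ := by
          refine EReal.sub_le_sub le_rfl ?_
          refine (EReal.coe_ennreal_le_coe_ennreal_iff.2 hpen).trans_eq ?_
          rw [EReal.coe_ennreal_ofReal, max_eq_left (by linarith)]

/-- Identification of the conditional expectation on a finite partition. -/
lemma condExp_cell {Ω : Type*} (m : MeasurableSpace Ω) [mΩ : MeasurableSpace Ω] (hm : m ≤ mΩ)
    (P : Measure Ω) [IsProbabilityMeasure P]
    {ι : Type*} [Countable ι] [MeasurableSpace ι] [DiscreteMeasurableSpace ι]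
    (f : Ω → ι) (hfm : Measurable[m] f)
    (hconst : ∀ s, MeasurableSet[m] s → ∀ x y, f x = f y → x ∈ s → y ∈ s)
    (X : Ω → ℝ) (hX : BddMeas X) :
    ∀ᵐ ω ∂P, (P[X|m]) ω = ∫ x, X x ∂(cellLaw P f (f ω)) := by
  have hf : Measurable f := hfm.mono hm le_rfl
  have hnull : ∀ᵐ ω ∂P, P (f ⁻¹' {f ω}) ≠ 0 := by
    rw [ae_iff]
    have : {ω | ¬ P (f ⁻¹' {f ω}) ≠ 0} ⊆ ⋃ i : {i // P (f ⁻¹' {i}) = 0}, f ⁻¹' {i.1} := by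
      intro ω hω
      rw [Set.mem_iUnion]
      exact ⟨⟨f ω, not_not.1 hω⟩, rfl⟩
    exact measure_mono_null this (measure_iUnion_null fun i => i.2)
  filter_upwards [hnull] with ω hω
  have hg : Measurable[m] (P[X|m]) := stronglyMeasurable_condExp.measurable
  have hgc : ∀ y ∈ f ⁻¹' {f ω}, (P[X|m]) y = (P[X|m]) ω := by
    intro y hy
    have : MeasurableSet[m] ((P[X|m]) ⁻¹' {(P[X|m]) ω}) := hg (measurableSet_singleton _)
    exact hconst _ this ω y hy.symm rfl
  have hs : MeasurableSet[m] (f ⁻¹' {f ω}) := hfm (measurableSet_singleton _)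
  have h1 := setIntegral_condExp hm (hX.integrable P) hs
  rw [setIntegral_congr_fun (hm _ hs) hgc, setIntegral_const, smul_eq_mul] at h1
  have h2 : cellLaw P f (f ω) = (P (f ⁻¹' {f ω}))⁻¹ • P.restrict (f ⁻¹' {f ω}) := by
    unfold cellLaw
    rw [if_neg hω]
    rfl
  rw [h2, integral_smul_measure, ← h1, smul_eq_mul, ENNReal.toReal_inv, measureReal_def,
    ← mul_assoc, inv_mul_cancel₀, one_mul]
  exact ENNReal.toReal_ne_zero.2 ⟨hω, measure_ne_top _ _⟩

lemma forward_lt [StandardBorelSpace Ω]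
    (P : Measure Ω) [IsProbabilityMeasure P] [NullSingletonClass P]
    (ρ : (Ω → ℝ) → ℝ) (hρ : IsRiskMeasure P ρ)
    (hFatou : ∀ (Xn : ℕ → Ω → ℝ) (X : Ω → ℝ) (M : ℝ), (∀ n, Measurable (Xn n)) →
      Measurable X → (∀ n ω, |Xn n ω| ≤ M) →
      (∀ᵐ ω ∂P, Tendsto (fun n => Xn n ω) atTop (𝓝 (X ω))) →
      ρ X ≤ liminf (fun n => ρ (Xn n)) atTop)
    (hlaw : LawInvariant P ρ) (X : Ω → ℝ) (hX : BddMeas X) (a : ℝ) (ha : a < ρ X) :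
    ∃ Q : Measure Ω, IsProbabilityMeasure Q ∧ Q ≪ P ∧
      (a : EReal) ≤ ((∫ ω, X ω ∂Q : ℝ) : EReal) - (minPenalty ρ Q : EReal) := by
  obtain ⟨hXm, M, hM⟩ := id hX
  let F := fun (n : ℕ) (ω : Ω) =>
    (⟨MeasurableSpace.countablePartitionSet n ω, MeasurableSpace.countablePartitionSet_mem n ω⟩ :
      MeasurableSpace.countablePartition Ω n)
  let mι : ∀ n, MeasurableSpace (MeasurableSpace.countablePartition Ω n) := fun n => ⊤
  have hdisc : ∀ n, DiscreteMeasurableSpace (MeasurableSpace.countablePartition Ω n) :=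
    fun n => ⟨fun _ => trivial⟩
  have hfin : ∀ n, Finite (MeasurableSpace.countablePartition Ω n) := fun n =>
    (MeasurableSpace.finite_countablePartition Ω n)
  have hFm : ∀ n, Measurable[countableFiltration Ω n] (F n) := fun n =>
    measurable_countablePartitionSet_subtype n _
  have hF : ∀ n, Measurable (F n) := fun n => (hFm n).mono ((countableFiltration Ω).le n) le_rfl
  have hcp := fun n => cellLaw_prob P (F n)
  set Z : ℕ → Ω → ℝ := fun n ω => ∫ x, X x ∂(cellLaw P (F n) (F n ω)) with hZ
  have hZm : ∀ n, Measurable (Z n) := fun n =>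
    (measurable_of_countable (fun i => ∫ x, X x ∂(cellLaw P (F n) i))).comp (hF n)
  have hZb : ∀ n ω, |Z n ω| ≤ M := by
    intro n ω
    have := norm_integral_le_of_norm_le_const (μ := cellLaw P (F n) (F n ω)) (f := X) (C := M)
      (ae_of_all _ hM)
    simpa using this
  have hcond : ∀ n, ∀ᵐ ω ∂P, (P[X|countableFiltration Ω n]) ω = Z n ω := by
    intro n
    refine condExp_cell _ ((countableFiltration Ω).le n) P (F n) (hFm n) ?_ X hX
    intro s hs x y hxy hx
    obtain ⟨S, hS, rfl⟩ := (MeasurableSpace.measurableSet_generateFrom_countablePartition_iff n s).1 hs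
    obtain ⟨t, ht, hxt⟩ := hx
    refine ⟨t, ht, ?_⟩
    have h1 := MeasurableSpace.countablePartitionSet_of_mem (hS ht) hxt
    have h2 : MeasurableSpace.countablePartitionSet n x = MeasurableSpace.countablePartitionSet n y :=
      congrArg Subtype.val hxy
    rw [← h1, h2]
    exact MeasurableSpace.mem_countablePartitionSet n y
  have hconv : ∀ᵐ ω ∂P, Tendsto (fun n => Z n ω) atTop (𝓝 (X ω)) := by
    have h1 := tendsto_ae_condExp (μ := P) (ℱ := countableFiltration Ω) X
    rw [iSup_countableFiltration, condExp_of_stronglyMeasurable le_rfl hXm.stronglyMeasurable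
      (hX.integrable P)] at h1
    filter_upwards [h1, ae_all_iff.2 hcond] with ω h2 h3
    simpa only [h3] using h2
  have hlim := hFatou Z X M hZm hXm hZb hconv
  have hex : ∃ n, a < ρ (Z n) := by
    by_contra! hcon
    refine absurd (le_of_le_liminf _ _ a (-M) hlim hcon fun n => ?_) (not_le.2 ha)
    rw [← hρ.const (-M)]
    exact hρ.mono _ _ ⟨measurable_const, |(-M)|, fun _ => le_rfl⟩ ⟨hZm n, M, hZb n⟩
      (ae_of_all _ fun ω => (abs_le.1 (hZb n ω)).1)
  obtain ⟨n, hn⟩ := hex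
  exact exists_dual P ρ hρ (F n) (hF n)
    (fun X' hX' => cellAverage_le P ρ hρ hFatou hlaw (F n) (hF n) X' hX') X hX a hn

end C

/-- A risk measure with the Fatou property is law invariant if and only if it
admits a penalty function `α` on `{Q ∈ 𝓟(Ω) : Q ≪ P}` satisfying `α(Q ∘ T⁻¹) ≤ α(Q)` for every
measure-preserving measurable `T : Ω → Ω`. -/
theorem statement0 {Ω : Type*} [MeasurableSpace Ω] [StandardBorelSpace Ω]
    (P : Measure Ω) [IsProbabilityMeasure P] [NullSingletonClass P]
    (ρ : (Ω → ℝ) → ℝ) (hρ : IsRiskMeasure P ρ)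
    (hFatou : ∀ (Xn : ℕ → Ω → ℝ) (X : Ω → ℝ) (M : ℝ), (∀ n, Measurable (Xn n)) →
      Measurable X → (∀ n ω, |Xn n ω| ≤ M) →
      (∀ᵐ ω ∂P, Tendsto (fun n => Xn n ω) atTop (𝓝 (X ω))) →
      ρ X ≤ liminf (fun n => ρ (Xn n)) atTop) :
    LawInvariant P ρ ↔
      ∃ α : Measure Ω → ℝ≥0∞,
        (∀ X : Ω → ℝ, BddMeas X →
          (ρ X : EReal) =
            ⨆ (Q : Measure Ω) (_ : IsProbabilityMeasure Q) (_ : Q ≪ P),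
              (((∫ ω, X ω ∂Q : ℝ) : EReal) - ((α Q : ℝ≥0∞) : EReal))) ∧
        (∀ Q : Measure Ω, IsProbabilityMeasure Q → Q ≪ P →
          ∀ T : Ω → Ω, Measurable T → P.map T = P → α (Q.map T) ≤ α Q) := by
  constructor
  · intro hlaw
    refine ⟨minPenalty ρ, fun X hX => le_antisymm ?_ ?_, ?_⟩
    · refine le_of_forall_lt fun b hb => ?_
      obtain ⟨a, hba, ha⟩ := EReal.lt_iff_exists_real_btwn.1 hb
      obtain ⟨Q, hQ, hQP, hle⟩ := forward_lt P ρ hρ hFatou hlaw X hX a (EReal.coe_lt_coe_iff.1 ha)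
      exact (hba.trans_le hle).trans_le
        (le_iSup_of_le Q (le_iSup_of_le hQ (le_iSup_of_le hQP le_rfl)))
    · refine iSup_le fun Q => iSup_le fun hQ => iSup_le fun hQP => ?_
      have h1 : ENNReal.ofReal ((∫ ω, X ω ∂Q) - ρ X) ≤ minPenalty ρ Q :=
        le_iSup_of_le X (le_iSup_of_le hX le_rfl)
      have h2 : (((∫ ω, X ω ∂Q) - ρ X : ℝ) : EReal) ≤ (minPenalty ρ Q : EReal) := by
        refine le_trans ?_ (EReal.coe_ennreal_le_coe_ennreal_iff.2 h1)
        rw [EReal.coe_ennreal_ofReal]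
        exact EReal.coe_le_coe_iff.2 (le_max_left _ _)
      refine (EReal.sub_le_sub le_rfl h2).trans_eq ?_
      rw [← EReal.coe_sub, sub_sub_cancel]
    · intro Q hQ hQP T hT hTP
      refine iSup_le fun X => iSup_le fun hX => ?_
      have hXT : BddMeas (fun ω => X (T ω)) := ⟨hX.1.comp hT, hX.2.imp fun M hM x => hM _⟩
      refine le_iSup_of_le (fun ω => X (T ω)) (le_iSup_of_le hXT ?_)
      rw [integral_map hT.aemeasurable hX.1.aestronglyMeasurable]
      have : ρ (fun ω => X (T ω)) = ρ X := by
        refine hlaw _ _ hXT hX ?_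
        have := Measure.map_map (μ := P) hX.1 hT
        rw [hTP] at this
        exact this.symm
      rw [this]
  · rintro ⟨α, hrep, hα⟩ X Y hX hY hXY
    exact le_antisymm (backward_le P ρ α hrep hα X Y hX hY hXY)
      (backward_le P ρ α hrep hα Y X hY hX hXY.symm)

end RiskDiv
end
end

section
/- Let ρ be a law invariant risk measure whose induced divergence α is simplified. Then for every Polish space E, the map (μ, ν) ↦ α(ν | μ) is Borel measurable on 𝓟(E) × 𝓟(E), where 𝓟(E) carries the Borel σ-field generated by the topology of weak convergence. -/
open MeasureTheory ProbabilityTheory Filter Topology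
open scoped ENNReal NNReal

noncomputable section

namespace RiskDiv

lemma exists_rv {Ω : Type*} [MeasurableSpace Ω] [StandardBorelSpace Ω]
    (P : Measure Ω) [IsProbabilityMeasure P] [NullSingletonClass P]
    {E : Type*} [MeasurableSpace E] [StandardBorelSpace E] (μ : Measure E)
    [IsProbabilityMeasure μ] : ∃ X : Ω → E, Measurable X ∧ P.map X = μ := by
  obtain ⟨U, hU, hUm⟩ := exists_uniform P
  have : Nonempty E := nonempty_of_isProbabilityMeasure μ
  obtain ⟨f, hf, hfm⟩ := Measure.exists_measurable_map_eq μ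
  exact ⟨f ∘ U, hf.comp hU, by rw [← Measure.map_map hf hU, hUm, hfm]⟩

lemma BddMeas.comp {E F : Type*} [MeasurableSpace E] [MeasurableSpace F] {f : F → ℝ}
    (hf : BddMeas f) {X : E → F} (hX : Measurable X) : BddMeas (f ∘ X) :=
  ⟨hf.1.comp hX, hf.2.imp fun _ h _ => h _⟩

lemma rhoMu_eq {Ω : Type*} [MeasurableSpace Ω] (P : Measure Ω) (ρ : (Ω → ℝ) → ℝ)
    (hLI : LawInvariant P ρ) {E : Type*} [MeasurableSpace E] (μ : Measure E) (f : E → ℝ)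
    (hf : BddMeas f) (X : Ω → E) (hX : Measurable X) (hXm : P.map X = μ) :
    rhoMu P ρ μ f = ρ (f ∘ X) := by
  have h : ∃ X : Ω → E, Measurable X ∧ P.map X = μ := ⟨X, hX, hXm⟩
  rw [rhoMu, dif_pos h]
  have hs := h.choose_spec
  apply hLI _ _ (hf.comp hs.1) (hf.comp hX)
  rw [← Measure.map_map hf.1 hs.1, ← Measure.map_map hf.1 hX, hs.2, hXm]

lemma rho_lip {Ω : Type*} [MeasurableSpace Ω] {P : Measure Ω} {ρ : (Ω → ℝ) → ℝ}
    (hρ : IsRiskMeasure P ρ) {f g : Ω → ℝ} (hf : BddMeas f) (hg : BddMeas g) {c : ℝ}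
    (h : ∀ x, f x ≤ g x + c) : ρ f ≤ ρ g + c := by
  rw [← hρ.cash g c hg]
  refine hρ.mono _ _ hf ⟨hg.1.add_const c, ?_⟩ (Eventually.of_forall h)
  obtain ⟨M, hM⟩ := hg.2
  exact ⟨M + |c|, fun x => (abs_add_le _ _).trans (by gcongr; exact hM x)⟩

lemma convex_sublevel {Ω : Type*} [MeasurableSpace Ω] {P : Measure Ω} {ρ : (Ω → ℝ) → ℝ}
    (hρ : IsRiskMeasure P ρ) (b : ℝ) : Convex ℝ {X : Ω → ℝ | BddMeas X ∧ ρ X ≤ b} := by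
  rintro f ⟨hf, hfb⟩ g ⟨hg, hgb⟩ s t hs ht hst
  obtain rfl : t = 1 - s := by linarith
  refine ⟨⟨(hf.1.const_smul s).add (hg.1.const_smul (1 - s)), ?_⟩, ?_⟩
  · obtain ⟨M, hM⟩ := hf.2
    obtain ⟨M', hM'⟩ := hg.2
    refine ⟨s * M + (1 - s) * M', fun x => ?_⟩
    simp only [Pi.add_apply, Pi.smul_apply, smul_eq_mul]
    refine (abs_add_le _ _).trans ?_
    rw [abs_mul, abs_mul, abs_of_nonneg hs, abs_of_nonneg ht]
    gcongr
    · exact hM x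
    · exact hM' x
  · refine (hρ.cvx f g s hf hg hs (by linarith)).trans ?_
    nlinarith

/-- The number of thresholds `p j` lying strictly above `U ω`. -/
def stepN {Ω : Type*} {K : ℕ} (U : Ω → ℝ) (p : Fin K → ℝ) (ω : Ω) : ℕ :=
  ∑ j, if U ω < p j then 1 else 0

lemma measurable_stepN {Ω : Type*} [MeasurableSpace Ω] {K : ℕ} {U : Ω → ℝ} (hU : Measurable U)
    (p : Fin K → ℝ) : Measurable (stepN U p) := by
  unfold stepN
  refine Finset.measurable_fun_sum _ fun j _ => ?_
  exact Measurable.ite (measurableSet_lt hU measurable_const) measurable_const measurable_const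

lemma stepN_le {Ω : Type*} {K : ℕ} (U : Ω → ℝ) (p : Fin K → ℝ) (ω : Ω) : stepN U p ω ≤ K := by
  unfold stepN
  rw [← Finset.card_filter]
  exact (Finset.card_le_univ _).trans (by simp)

lemma stepN_mono {Ω : Type*} {K : ℕ} (U : Ω → ℝ) {p q : Fin K → ℝ} (h : ∀ j, p j ≤ q j) (ω : Ω) :
    stepN U p ω ≤ stepN U q ω := by
  unfold stepN
  rw [← Finset.card_filter, ← Finset.card_filter]
  apply Finset.card_le_card
  intro j hj
  simp only [Finset.mem_filter, Finset.mem_univ, true_and] at hj ⊢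
  exact hj.trans_le (h j)

lemma lt_stepN_iff {Ω : Type*} {K : ℕ} (U : Ω → ℝ) {p : Fin K → ℝ} (hp : Antitone p) (ω : Ω)
    (j : Fin K) : (j : ℕ) < stepN U p ω ↔ U ω < p j := by
  unfold stepN
  rw [← Finset.card_filter]
  constructor
  · intro h
    by_contra hj
    have : (Finset.univ.filter fun i => U ω < p i) ⊆ Finset.Iio j := by
      intro i hi
      simp only [Finset.mem_filter, Finset.mem_univ, true_and, Finset.mem_Iio] at hi ⊢
      by_contra hij
      exact hj (hi.trans_le (hp (le_of_not_gt hij)))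
    have := Finset.card_le_card this
    rw [Fin.card_Iio] at this
    omega
  · intro h
    have : Finset.Iic j ⊆ (Finset.univ.filter fun i => U ω < p i) := by
      intro i hi
      simp only [Finset.mem_filter, Finset.mem_univ, true_and, Finset.mem_Iic] at hi ⊢
      exact h.trans_le (hp hi)
    have := Finset.card_le_card this
    rw [Fin.card_Iic] at this
    omega

lemma law_stepN {Ω : Type*} [MeasurableSpace Ω] {P : Measure Ω} [IsProbabilityMeasure P]
    {U : Ω → ℝ} (hU : Measurable U)
    (hUlaw : ∀ t : ℝ, 0 ≤ t → t ≤ 1 → P {ω | U ω < t} = ENNReal.ofReal t)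
    {K : ℕ} {N : Ω → ℕ} (hN : Measurable N) (hNK : ∀ ω, N ω ≤ K) :
    P.map N = P.map (stepN U fun j : Fin K => P.real {ω | (j : ℕ) < N ω}) := by
  set p := fun j : Fin K => P.real {ω | (j : ℕ) < N ω} with hp
  have hanti : Antitone p := by
    intro i j hij
    refine measureReal_mono ?_
    intro ω hω
    exact lt_of_le_of_lt (show (i : ℕ) ≤ j from hij) hω
  have hS := measurable_stepN hU p
  have := Measure.isProbabilityMeasure_map hN.aemeasurable (μ := P)
  refine Measure.ext_of_Ici _ _ fun n => ?_
  rw [Measure.map_apply hN measurableSet_Ici, Measure.map_apply hS measurableSet_Ici]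
  rcases n with _ | j
  · have : (Set.Ici 0 : Set ℕ) = Set.univ := by ext; simp
    simp [this]
  · by_cases hj : j < K
    · have e1 : stepN U p ⁻¹' Set.Ici (j + 1) = {ω | U ω < p ⟨j, hj⟩} := by
        ext ω
        exact lt_stepN_iff U hanti ω ⟨j, hj⟩
      rw [e1, hUlaw _ measureReal_nonneg measureReal_le_one]
      simp only
      rw [ofReal_measureReal (measure_ne_top _ _)]
      rfl
    · have e1 : stepN U p ⁻¹' Set.Ici (j + 1) = ∅ := by
        ext ω
        have := stepN_le U p ω
        simp
        omega
      have e2 : N ⁻¹' Set.Ici (j + 1) = ∅ := by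
        ext ω
        have := hNK ω
        simp
        omega
      rw [e1, e2]

lemma bddMeas_affine {Ω : Type*} [MeasurableSpace Ω] {K : ℕ} {N : Ω → ℕ} (hN : Measurable N)
    (hNK : ∀ ω, N ω ≤ K) (a h : ℝ) : BddMeas (fun ω => a + h * (N ω : ℝ)) := by
  refine ⟨by fun_prop, |a| + |h| * K, fun ω => (abs_add_le _ _).trans ?_⟩
  rw [abs_mul, Nat.abs_cast]
  gcongr
  exact_mod_cast hNK ω

lemma rho_stepN {Ω : Type*} [MeasurableSpace Ω] {P : Measure Ω} [IsProbabilityMeasure P]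
    {ρ : (Ω → ℝ) → ℝ} (hLI : LawInvariant P ρ)
    {U : Ω → ℝ} (hU : Measurable U)
    (hUlaw : ∀ t : ℝ, 0 ≤ t → t ≤ 1 → P {ω | U ω < t} = ENNReal.ofReal t)
    {K : ℕ} {N : Ω → ℕ} (hN : Measurable N) (hNK : ∀ ω, N ω ≤ K) (a h : ℝ)
    (p : Fin K → ℝ) (hp : ∀ j, p j = P.real {ω | (j : ℕ) < N ω}) :
    ρ (fun ω => a + h * (N ω : ℝ)) = ρ (fun ω => a + h * (stepN U p ω : ℝ)) := by
  obtain rfl : p = _ := funext hp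
  refine hLI _ _ (bddMeas_affine hN hNK a h)
    (bddMeas_affine (measurable_stepN hU _) (stepN_le U _) a h) ?_
  have hφ : Measurable fun n : ℕ => a + h * (n : ℝ) := by fun_prop
  have h1 := congrArg (Measure.map fun n : ℕ => a + h * (n : ℝ)) (law_stepN hU hUlaw hN hNK)
  rwa [Measure.map_map hφ hN, Measure.map_map hφ (measurable_stepN hU _)] at h1

/-- Key estimate: mixing with the lowest value decreases the risk only a little. -/
lemma rho_mix {Ω : Type*} [MeasurableSpace Ω] [StandardBorelSpace Ω]
    {P : Measure Ω} [IsProbabilityMeasure P] [NullSingletonClass P]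
    {ρ : (Ω → ℝ) → ℝ} (hρ : IsRiskMeasure P ρ) (hLI : LawInvariant P ρ)
    {U : Ω → ℝ} (hU : Measurable U)
    (hUlaw : ∀ t : ℝ, 0 ≤ t → t ≤ 1 → P {ω | U ω < t} = ENNReal.ofReal t)
    {E : Type*} [MeasurableSpace E] [StandardBorelSpace E] (μ : Measure E)
    [IsProbabilityMeasure μ]
    {K : ℕ} {N : E → ℕ} (hN : Measurable N) (hNK : ∀ x, N x ≤ K) (a h : ℝ) (hh : 0 ≤ h) (n : ℕ) :
    rhoMu P ρ μ (fun x => a + h * (N x : ℝ)) ≤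
      ρ (fun ω => a + h * (stepN U
        (fun j : Fin K => (1 - 1 / ((n : ℝ) + 1)) * μ.real {x | (j : ℕ) < N x}) ω : ℝ))
        + h * K / ((n : ℝ) + 1) := by
  set p := (fun j : Fin K => (1 - 1 / ((n : ℝ) + 1)) * μ.real {x | (j : ℕ) < N x}) with hp
  let κ : Measure (Fin (n + 1)) := uniformOn Set.univ
  have hκ : IsProbabilityMeasure κ :=
    isProbabilityMeasure_uniformOn Set.finite_univ Set.univ_nonempty
  obtain ⟨Z, hZ, hZm⟩ := exists_rv P (μ.prod κ)
  have hZ1 : P.map (fun ω => (Z ω).1) = μ := by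
    have := Measure.map_map (μ := P) (g := Prod.fst) measurable_fst hZ
    rw [hZm, Measure.map_fst_prod] at this
    simpa [Function.comp_def] using this.symm
  rw [rhoMu_eq P ρ hLI μ _ (bddMeas_affine hN hNK a h) (fun ω => (Z ω).1) hZ.fst hZ1]
  let M : Fin (n + 1) → E × Fin (n + 1) → ℕ := fun m z => if z.2 = m then 0 else N z.1
  have hM : ∀ m, Measurable (M m) := fun m =>
    Measurable.ite (measurable_snd (measurableSet_singleton m)) measurable_const
      (hN.comp measurable_fst)
  have hMK : ∀ m z, M m z ≤ K := by
    intro m z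
    simp only [M]
    split_ifs
    · exact Nat.zero_le _
    · exact hNK _
  have hκm : ∀ m, κ.real {m}ᶜ = 1 - 1 / ((n : ℝ) + 1) := by
    intro m
    rw [measureReal_compl (measurableSet_singleton m)]
    simp [κ, uniformOn_univ, measureReal_def]
    exact_mod_cast ENNReal.toReal_natCast (n + 1)
  have htail : ∀ m (j : Fin K), p j = P.real {ω | (j : ℕ) < M m (Z ω)} := by
    intro m j
    have : {ω | (j : ℕ) < M m (Z ω)} = Z ⁻¹' ({x | (j : ℕ) < N x} ×ˢ {m}ᶜ) := by
      ext ω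
      simp only [M, Set.mem_ofPred_eq, Set.mem_preimage, Set.mem_prod, Set.mem_compl_iff,
        Set.mem_singleton_iff]
      split_ifs with h <;> simp [h]
    have hms : MeasurableSet ({x | (j : ℕ) < N x} ×ˢ ({m}ᶜ : Set (Fin (n+1)))) :=
      (measurableSet_lt measurable_const hN).prod (measurableSet_singleton m).compl
    rw [this, ← map_measureReal_apply hZ hms, hZm, measureReal_prod_prod, hκm, hp, mul_comm]
  set b := ρ (fun ω => a + h * (stepN U p ω : ℝ)) with hb
  have hmem : ∀ m ∈ (Finset.univ : Finset (Fin (n + 1))),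
      (fun ω => a + h * (M m (Z ω) : ℝ)) ∈ {X : Ω → ℝ | BddMeas X ∧ ρ X ≤ b} := by
    intro m _
    exact ⟨bddMeas_affine ((hM m).comp hZ) (fun ω => hMK m _) a h,
      (rho_stepN hLI hU hUlaw ((hM m).comp hZ) (fun ω => hMK m _) a h p (htail m)).le⟩
  have hn : (0 : ℝ) < (n : ℝ) + 1 := by positivity
  have hav := (convex_sublevel hρ b).sum_mem (t := Finset.univ)
    (w := fun _ : Fin (n + 1) => 1 / ((n : ℝ) + 1)) (fun _ _ => by positivity)
    (by simp; field_simp) hmem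
  refine (rho_lip hρ ?_ hav.1 ?_).trans (add_le_add_left hav.2 _)
  · exact (bddMeas_affine hN hNK a h).comp hZ.fst
  · intro ω
    simp only [Function.comp, Finset.sum_apply, Pi.smul_apply, smul_eq_mul]
    have hs : ∑ m : Fin (n + 1), (M m (Z ω) : ℝ) = n * N (Z ω).1 := by
      have : ∀ m : Fin (n + 1), (M m (Z ω) : ℝ)
          = (N (Z ω).1 : ℝ) - if (Z ω).2 = m then (N (Z ω).1 : ℝ) else 0 := by
        intro m
        simp only [M]
        split_ifs <;> simp
      simp_rw [this]
      simp
      ring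
    rw [← Finset.mul_sum, Finset.sum_add_distrib, ← Finset.mul_sum, hs]
    have hle : h * (N (Z ω).1 : ℝ) ≤ h * K := by
      gcongr
      exact_mod_cast hNK _
    simp
    field_simp
    nlinarith

lemma measurable_rhoMu_simple {Ω : Type*} [MeasurableSpace Ω] [StandardBorelSpace Ω]
    {P : Measure Ω} [IsProbabilityMeasure P] [NullSingletonClass P]
    {ρ : (Ω → ℝ) → ℝ} (hρ : IsRiskMeasure P ρ) (hLI : LawInvariant P ρ)
    {E : Type*} [MeasurableSpace E] [StandardBorelSpace E]
    {K : ℕ} {N : E → ℕ} (hN : Measurable N) (hNK : ∀ x, N x ≤ K) (a h : ℝ) (hh : 0 ≤ h) :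
    Measurable fun μ : ProbabilityMeasure E =>
      rhoMu P ρ (μ : Measure E) (fun x => a + h * (N x : ℝ)) := by
  obtain ⟨U', hU', hU'm⟩ := exists_uniform P
  let U : Ω → ℝ := fun ω => U' ω
  have hU : Measurable U := hU'.subtype_val
  have hUlaw : ∀ t : ℝ, 0 ≤ t → t ≤ 1 → P {ω | U ω < t} = ENNReal.ofReal t := by
    intro t h0 h1
    have := unitInterval.volume_Iio ⟨t, h0, h1⟩
    rw [← hU'm, Measure.map_apply hU' measurableSet_Iio] at this
    exact this
  let G : (Fin K → ℝ) → ℝ := fun p => ρ (fun ω => a + h * (stepN U p ω : ℝ))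
  have hGm : ∀ p q : Fin K → ℝ, (∀ j, p j ≤ q j) → G p ≤ G q := by
    intro p q hpq
    refine hρ.mono _ _ (bddMeas_affine (measurable_stepN hU _) (stepN_le U _) a h)
      (bddMeas_affine (measurable_stepN hU _) (stepN_le U _) a h) (Eventually.of_forall fun ω => ?_)
    have := stepN_mono U hpq ω
    gcongr
  have hG : ∀ μ : ProbabilityMeasure E, rhoMu P ρ (μ : Measure E) (fun x => a + h * (N x : ℝ))
      = G fun j => (μ : Measure E).real {x | (j : ℕ) < N x} := by
    intro μ
    obtain ⟨X, hX, hXm⟩ := exists_rv P (μ : Measure E)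
    rw [rhoMu_eq P ρ hLI _ _ (bddMeas_affine hN hNK a h) X hX hXm]
    refine rho_stepN hLI hU hUlaw (hN.comp hX) (fun ω => hNK _) a h _ fun j => ?_
    rw [← hXm, map_measureReal_apply hX (measurableSet_lt measurable_const hN)]
    rfl
  refine measurable_of_Ioi fun c => ?_
  have hset : (fun μ : ProbabilityMeasure E =>
      rhoMu P ρ (μ : Measure E) (fun x => a + h * (N x : ℝ))) ⁻¹' Set.Ioi c
      = ⋃ (r : Fin K → ℚ) (_ : c < G fun j => (r j : ℝ)), ⋂ j,
        {μ : ProbabilityMeasure E | (r j : ℝ) ≤ (μ : Measure E).real {x | (j : ℕ) < N x}} := by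
    ext μ
    simp only [Set.mem_preimage, Set.mem_Ioi, Set.mem_iUnion, Set.mem_iInter, Set.mem_ofPred_eq,
      exists_prop]
    constructor
    · intro hc
      have hlim : Tendsto (fun n : ℕ => h * K / ((n : ℝ) + 1)) atTop (𝓝 0) := by
        have := (tendsto_one_div_add_atTop_nhds_zero_nat (𝕜 := ℝ)).const_mul (h * K)
        simpa only [mul_one_div, mul_zero] using this
      obtain ⟨n, hn⟩ := (hlim.eventually (gt_mem_nhds (sub_pos.mpr hc))).exists
      have hmix := rho_mix hρ hLI hU hUlaw (μ : Measure E) hN hNK a h hh n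
      have hr : ∀ j : Fin K, ∃ r : ℚ,
          (1 - 1 / ((n : ℝ) + 1)) * (μ : Measure E).real {x | (j : ℕ) < N x} ≤ r ∧
          (r : ℝ) ≤ (μ : Measure E).real {x | (j : ℕ) < N x} := by
        intro j
        have h0 : 0 ≤ (μ : Measure E).real {x | (j : ℕ) < N x} := measureReal_nonneg
        rcases eq_or_lt_of_le h0 with h0 | h0
        · exact ⟨0, by simp [← h0]⟩
        · obtain ⟨r, h1, h2⟩ := exists_rat_btwn (show
            (1 - 1 / ((n : ℝ) + 1)) * (μ : Measure E).real {x | (j : ℕ) < N x}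
              < (μ : Measure E).real {x | (j : ℕ) < N x} by
            have : 0 < 1 / ((n : ℝ) + 1) := by positivity
            nlinarith)
          exact ⟨r, h1.le, h2.le⟩
      choose r hr1 hr2 using hr
      refine ⟨r, ?_, hr2⟩
      have := hGm _ _ hr1
      simp only [G] at this ⊢
      linarith
    · rintro ⟨r, hr, hr2⟩
      rw [hG]
      exact hr.trans_le (hGm _ _ hr2)
  rw [hset]
  refine MeasurableSet.iUnion fun r => MeasurableSet.iUnion fun _ => MeasurableSet.iInter fun j => ?_
  refine measurableSet_le measurable_const ?_
  exact ((Measure.measurable_coe (measurableSet_lt measurable_const hN)).comp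
    measurable_subtype_coe).ennreal_toReal

lemma measurable_rhoMu {Ω : Type*} [MeasurableSpace Ω] [StandardBorelSpace Ω]
    {P : Measure Ω} [IsProbabilityMeasure P] [NullSingletonClass P]
    {ρ : (Ω → ℝ) → ℝ} (hρ : IsRiskMeasure P ρ) (hLI : LawInvariant P ρ)
    {E : Type*} [MeasurableSpace E] [StandardBorelSpace E] {g : E → ℝ} (hg : BddMeas g) :
    Measurable fun μ : ProbabilityMeasure E => rhoMu P ρ (μ : Measure E) g := by
  obtain ⟨M, hM⟩ := hg.2
  let N : ℕ → E → ℕ := fun k x => ⌊(g x + M) * ((k : ℝ) + 1)⌋₊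
  have hN : ∀ k, Measurable (N k) := fun k =>
    Nat.measurable_floor.comp ((hg.1.add_const M).mul_const _)
  have hNK : ∀ k x, N k x ≤ ⌊(M + M) * ((k : ℝ) + 1)⌋₊ := by
    intro k x
    have := (abs_le.mp (hM x)).2
    exact Nat.floor_le_floor (by gcongr)
  let gk : ℕ → E → ℝ := fun k x => -M + (1 / ((k : ℝ) + 1)) * (N k x : ℝ)
  have hgk : ∀ k, BddMeas (gk k) := fun k => bddMeas_affine (hN k) (hNK k) _ _
  have hb : ∀ k x, gk k x ≤ g x + 0 ∧ g x ≤ gk k x + 1 / ((k : ℝ) + 1) := by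
    intro k x
    have hk : (0 : ℝ) < (k : ℝ) + 1 := by positivity
    have h0 : 0 ≤ (g x + M) * ((k : ℝ) + 1) := by
      have := (abs_le.mp (hM x)).1
      exact mul_nonneg (by linarith) hk.le
    have h1 := Nat.floor_le h0
    have h2 := Nat.lt_floor_add_one ((g x + M) * ((k : ℝ) + 1))
    have h3 : (N k x : ℝ) / ((k : ℝ) + 1) ≤ g x + M := by
      rw [div_le_iff₀ hk]; exact h1
    have h4 : g x + M ≤ ((N k x : ℝ) + 1) / ((k : ℝ) + 1) := by
      rw [le_div_iff₀ hk]; exact h2.le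
    rw [add_div] at h4
    simp only [gk, one_div_mul_eq_div]
    constructor <;> linarith
  refine measurable_of_tendsto_metrizable (f := fun k (μ : ProbabilityMeasure E) =>
    rhoMu P ρ (μ : Measure E) (gk k))
    (fun k => measurable_rhoMu_simple hρ hLI (hN k) (hNK k) _ _ (by positivity)) ?_
  rw [tendsto_pi_nhds]
  intro μ
  obtain ⟨X, hX, hXm⟩ := exists_rv P (μ : Measure E)
  have e : ∀ f : E → ℝ, BddMeas f → rhoMu P ρ (μ : Measure E) f = ρ (f ∘ X) :=
    fun f hf => rhoMu_eq P ρ hLI _ _ hf X hX hXm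
  rw [e g hg]
  simp_rw [fun k => e (gk k) (hgk k)]
  have hl : Tendsto (fun k : ℕ => ρ (g ∘ X) - 1 / ((k : ℝ) + 1)) atTop (𝓝 (ρ (g ∘ X))) := by
    simpa using (tendsto_one_div_add_atTop_nhds_zero_nat (𝕜 := ℝ)).const_sub (ρ (g ∘ X))
  refine tendsto_of_tendsto_of_tendsto_of_le_of_le hl tendsto_const_nhds ?_ ?_
  · intro k
    have := rho_lip hρ (hg.comp hX) ((hgk k).comp hX) (c := 1 / ((k : ℝ) + 1))
      (fun ω => (hb k (X ω)).2)
    simp only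
    linarith
  · intro k
    have := rho_lip hρ ((hgk k).comp hX) (hg.comp hX) (c := 0)
      (fun ω => (hb k (X ω)).1)
    simp only
    linarith

/-- The identity from the weak Borel σ-algebra to the evaluation σ-algebra is measurable. -/
lemma measurable_toMeasure_borel (E : Type*) [TopologicalSpace E] [MeasurableSpace E]
    [PolishSpace E] [BorelSpace E] :
    @Measurable (ProbabilityMeasure E) (ProbabilityMeasure E)
      (borel (ProbabilityMeasure E)) inferInstance id := by
  let := TopologicalSpace.upgradeIsCompletelyMetrizable E
  refine @Measurable.subtype_mk (ProbabilityMeasure E) _ (borel _) _ _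
    (fun μ => (μ : Measure E)) ?_ (fun μ => μ.2)
  refine @Measurable.measure_of_isPiSystem_of_isProbabilityMeasure (ProbabilityMeasure E) _
    (borel _) _ _ _ {s : Set E | IsClosed s}
    (BorelSpace.measurable_eq.trans borel_eq_generateFrom_isClosed)
    isPiSystem_isClosed ?_
  intro F hF
  have hF : IsClosed F := hF
  let : MeasurableSpace (ProbabilityMeasure E) := borel _
  have : BorelSpace (ProbabilityMeasure E) := ⟨rfl⟩
  refine measurable_of_tendsto_metrizable (f := fun n (μ : ProbabilityMeasure E) =>
    ∫⁻ x, (hF.apprSeq n x : ℝ≥0∞) ∂(μ : Measure E)) ?_ ?_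
  · intro n
    exact (ProbabilityMeasure.continuous_lintegral_boundedContinuousFunction _).measurable
  · rw [tendsto_pi_nhds]
    intro μ
    exact HasOuterApproxClosed.tendsto_lintegral_apprSeq hF μ

lemma bddMeas_continuous {f : Set.Icc (0:ℝ) 1 → ℝ} (hf : Continuous f) : BddMeas f := by
  refine ⟨hf.measurable, ?_⟩
  obtain ⟨C, hC⟩ := isCompact_univ.exists_bound_of_continuousOn hf.continuousOn
  exact ⟨C, fun x => hC x (Set.mem_univ x)⟩

lemma BddMeas.integrable_s3 {E : Type*} [MeasurableSpace E] {f : E → ℝ} (hf : BddMeas f)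
    (μ : Measure E) [IsFiniteMeasure μ] : Integrable f μ := by
  obtain ⟨M, hM⟩ := hf.2
  exact Integrable.of_bound hf.1.aestronglyMeasurable M (Eventually.of_forall hM)

/-- Invariance of the divergence under measurable embeddings. -/
lemma divergence_map {Ω : Type*} [MeasurableSpace Ω] [StandardBorelSpace Ω]
    {P : Measure Ω} [IsProbabilityMeasure P] [NullSingletonClass P]
    {ρ : (Ω → ℝ) → ℝ} (hLI : LawInvariant P ρ)
    {E F : Type*} [MeasurableSpace E] [StandardBorelSpace E] [MeasurableSpace F]
    {φ : E → F} (hφ : MeasurableEmbedding φ) (ν μ : Measure E) [IsProbabilityMeasure μ] :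
    divergence P ρ ν μ = divergence P ρ (ν.map φ) (μ.map φ) := by
  obtain ⟨X, hX, hXm⟩ := exists_rv P μ
  have hXm' : P.map (φ ∘ X) = μ.map φ := by rw [← Measure.map_map hφ.measurable hX, hXm]
  have key : ∀ f : F → ℝ, BddMeas f →
      (∫ x, f x ∂(ν.map φ)) - rhoMu P ρ (μ.map φ) f
        = (∫ x, (f ∘ φ) x ∂ν) - rhoMu P ρ μ (f ∘ φ) := by
    intro f hf
    rw [hφ.integral_map, rhoMu_eq P ρ hLI _ _ hf _ (hφ.measurable.comp hX) hXm',
      rhoMu_eq P ρ hLI _ _ (hf.comp hφ.measurable) X hX hXm]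
    rfl
  apply le_antisymm
  · refine iSup₂_le fun f hf => ?_
    have hext : BddMeas (Function.extend φ f fun _ => 0) := by
      refine ⟨hφ.measurable_extend hf.1 measurable_const, ?_⟩
      obtain ⟨M, hM⟩ := hf.2
      refine ⟨max M 0, fun y => ?_⟩
      by_cases hy : ∃ x, φ x = y
      · obtain ⟨x, rfl⟩ := hy
        rw [hφ.injective.extend_apply]
        exact (hM x).trans (le_max_left _ _)
      · rw [Function.extend_apply' _ _ _ hy]
        simp
    have h1 := key _ hext
    rw [show (Function.extend φ f fun _ => 0) ∘ φ = f from
      funext fun x => hφ.injective.extend_apply _ _ x] at h1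
    rw [← h1]
    exact le_iSup₂_of_le (Function.extend φ f fun _ => 0) hext le_rfl
  · refine iSup₂_le fun f hf => ?_
    rw [key f hf]
    exact le_iSup₂_of_le (f ∘ φ) (hf.comp hφ.measurable) le_rfl

lemma measurable_iSup_nat {α : Type*} (m : MeasurableSpace α) {f : ℕ → α → ℝ≥0∞}
    (hf : ∀ n, Measurable (f n)) : Measurable fun p => ⨆ n, f n p := Measurable.iSup hf

/-- If the divergence `α` induced by a law invariant risk measure `ρ` is
simplified, then for every Polish space `E` the map `(μ, ν) ↦ α(ν|μ)` is Borel measurable on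
`𝓟(E) × 𝓟(E)`, where `𝓟(E)` carries the Borel σ-field generated by the topology of weak
convergence. -/
theorem statement3 {Ω : Type*} [MeasurableSpace Ω] [StandardBorelSpace Ω]
    (P : Measure Ω) [IsProbabilityMeasure P] [NullSingletonClass P]
    (ρ : (Ω → ℝ) → ℝ) (hρ : IsRiskMeasure P ρ) (hLI : LawInvariant P ρ)
    (hSimp : Simplified P ρ)
    (E : Type) [TopologicalSpace E] [MeasurableSpace E] [PolishSpace E] [BorelSpace E] :
    @Measurable (ProbabilityMeasure E × ProbabilityMeasure E) ℝ≥0∞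
      (borel (ProbabilityMeasure E × ProbabilityMeasure E)) inferInstance
      (fun p => divergence P ρ (p.2 : Measure E) (p.1 : Measure E)) := by
  have hSB : StandardBorelSpace E := inferInstance
  rcases isEmpty_or_nonempty E with hE | hE
  · have : IsEmpty (ProbabilityMeasure E × ProbabilityMeasure E) :=
      ⟨fun p => hE.elim p.1.nonempty.some⟩
    exact fun s _ => by rw [Set.eq_empty_of_isEmpty (_ ⁻¹' s)]; exact @MeasurableSet.empty _ (borel _)
  let φ : E → Set.Icc (0:ℝ) 1 := unitInterval.sigmoid ∘ embeddingReal E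
  have hφ : MeasurableEmbedding φ := measurableEmbedding_sigmoid_comp_embeddingReal E
  let d : ℕ → C(Set.Icc (0:ℝ) 1, ℝ) := TopologicalSpace.denseSeq _
  have hd : DenseRange d := TopologicalSpace.denseRange_denseSeq _
  -- reduction to a countable supremum
  have hrepr : ∀ p : ProbabilityMeasure E × ProbabilityMeasure E,
      divergence P ρ (p.2 : Measure E) (p.1 : Measure E)
        = ⨆ n, ENNReal.ofReal ((∫ x, (d n ∘ φ) x ∂(p.2 : Measure E))
          - rhoMu P ρ (p.1 : Measure E) (d n ∘ φ)) := by
    rintro ⟨μ, ν⟩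
    obtain ⟨X, hX, hXm⟩ := exists_rv P (μ : Measure E)
    have hXm' : P.map (φ ∘ X) = (μ : Measure E).map φ := by
      rw [← Measure.map_map hφ.measurable hX, hXm]
    have h1 : IsProbabilityMeasure ((μ : Measure E).map φ) :=
      Measure.isProbabilityMeasure_map hφ.measurable.aemeasurable
    have h2 : IsProbabilityMeasure ((ν : Measure E).map φ) :=
      Measure.isProbabilityMeasure_map hφ.measurable.aemeasurable
    have hb : ∀ f : C(Set.Icc (0:ℝ) 1, ℝ), BddMeas f := fun f => bddMeas_continuous f.continuous
    have key : ∀ f : C(Set.Icc (0:ℝ) 1, ℝ),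
        (∫ x, f x ∂((ν : Measure E).map φ)) - rhoMu P ρ ((μ : Measure E).map φ) f
        = (∫ x, (f ∘ φ) x ∂(ν : Measure E)) - rhoMu P ρ (μ : Measure E) (f ∘ φ) := by
      intro f
      rw [hφ.integral_map, rhoMu_eq P ρ hLI _ _ (hb f) _ (hφ.measurable.comp hX) hXm',
        rhoMu_eq P ρ hLI _ _ ((hb f).comp hφ.measurable) X hX hXm]
      rfl
    dsimp only
    rw [divergence_map hLI hφ, hSimp _ _ h1 h2]
    let J : C(Set.Icc (0:ℝ) 1, ℝ) → ℝ := fun f =>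
      (∫ x, f x ∂((ν : Measure E).map φ)) - rhoMu P ρ ((μ : Measure E).map φ) f
    have hle : ∀ (f g : C(Set.Icc (0:ℝ) 1, ℝ)) x, f x ≤ g x + dist f g := by
      intro f g x
      have := (abs_le.mp ((Real.dist_eq _ _).symm.le.trans (ContinuousMap.dist_apply_le_dist x
        (f := f) (g := g)))).2
      linarith
    have hJ1 : ∀ f g : C(Set.Icc (0:ℝ) 1, ℝ), J f ≤ J g + 2 * dist f g := by
      intro f g
      have e1 : (∫ x, f x ∂((ν : Measure E).map φ))
          ≤ (∫ x, g x ∂((ν : Measure E).map φ)) + dist f g := by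
        calc (∫ x, f x ∂((ν : Measure E).map φ))
            ≤ ∫ x, (g x + dist f g) ∂((ν : Measure E).map φ) :=
              integral_mono ((hb f).integrable_s3 _)
                (((hb g).integrable_s3 _).add (integrable_const _)) (hle f g)
          _ = _ := by
              rw [integral_add ((hb g).integrable_s3 _) (integrable_const _)]
              simp
      have e2 : rhoMu P ρ ((μ : Measure E).map φ) g
          ≤ rhoMu P ρ ((μ : Measure E).map φ) f + dist f g := by
        rw [rhoMu_eq P ρ hLI _ _ (hb f) _ (hφ.measurable.comp hX) hXm',
          rhoMu_eq P ρ hLI _ _ (hb g) _ (hφ.measurable.comp hX) hXm']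
        refine rho_lip hρ ((hb g).comp (hφ.measurable.comp hX))
          ((hb f).comp (hφ.measurable.comp hX)) fun ω => ?_
        rw [dist_comm]
        exact hle g f _
      simp only [J]
      linarith
    have hJ : Continuous J := by
      refine (LipschitzWith.of_le_add_mul 2 fun f g => ?_).continuous
      simpa using hJ1 f g
    have hcl : IsClosed {f | ENNReal.ofReal (J f) ≤ ⨆ n, ENNReal.ofReal (J (d n))} :=
      isClosed_le (ENNReal.continuous_ofReal.comp hJ) continuous_const
    have hall : ∀ f, ENNReal.ofReal (J f) ≤ ⨆ n, ENNReal.ofReal (J (d n)) := fun f =>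
      hd.induction_on f hcl fun n => le_iSup (fun n => ENNReal.ofReal (J (d n))) n
    simp_rw [← key]
    apply le_antisymm
    · exact iSup₂_le fun f hf => hall ⟨f, hf⟩
    · exact iSup_le fun n => le_iSup₂_of_le (d n : Set.Icc (0:ℝ) 1 → ℝ) (d n).continuous le_rfl
  rw [show (fun p : ProbabilityMeasure E × ProbabilityMeasure E =>
    divergence P ρ (p.2 : Measure E) (p.1 : Measure E)) = _ from funext hrepr]
  let mE := borel (ProbabilityMeasure E × ProbabilityMeasure E)
  have hfst : @Measurable _ (ProbabilityMeasure E) mE inferInstance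
      (fun p : ProbabilityMeasure E × ProbabilityMeasure E => p.1) :=
    (measurable_toMeasure_borel E).comp (continuous_fst.borel_measurable)
  have hsnd : @Measurable _ (ProbabilityMeasure E) mE inferInstance
      (fun p : ProbabilityMeasure E × ProbabilityMeasure E => p.2) :=
    (measurable_toMeasure_borel E).comp (continuous_snd.borel_measurable)
  refine measurable_iSup_nat mE fun n => ?_
  have hbn : BddMeas (d n ∘ φ) := (bddMeas_continuous (d n).continuous).comp hφ.measurable
  have hInteg : Measurable fun μ : ProbabilityMeasure E =>
      ∫ x, (d n ∘ φ) x ∂(μ : Measure E) := by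
    let κ : Kernel (ProbabilityMeasure E) E := ⟨fun μ => μ, measurable_subtype_coe⟩
    have : StronglyMeasurable fun μ => ∫ x, (d n ∘ φ) x ∂(κ μ) :=
      hbn.1.stronglyMeasurable.integral_kernel
    exact this.measurable
  have hA := hInteg.comp hsnd
  have hB := (measurable_rhoMu hρ hLI hbn).comp hfst
  have hC := hA.sub hB
  exact hC.ennreal_ofReal

end RiskDiv
end
end

section
/- Let ρ be a law invariant risk measure that is Lebesgue continuous, with induced divergence α. Then for every Polish space E and all μ, ν ∈ 𝓟(E), α(ν|μ) = sup{∫_E f dν − ρ_μ(f) : f : E → ℝ bounded continuous}. In particular, α is simplified. -/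
open MeasureTheory ProbabilityTheory Filter Topology
open scoped ENNReal NNReal

noncomputable section

namespace RiskDiv

/-- `ρ` is Lebesgue continuous: `ρ(X_n) → ρ(X)` whenever `(X_n)` is uniformly bounded,
measurable, and converges a.s. to `X`. -/
def LebesgueContinuous {Ω : Type*} [MeasurableSpace Ω] (P : Measure Ω)
    (ρ : (Ω → ℝ) → ℝ) : Prop :=
  ∀ (Xn : ℕ → Ω → ℝ) (X : Ω → ℝ) (M : ℝ), (∀ n, Measurable (Xn n)) → Measurable X →
    (∀ n ω, |Xn n ω| ≤ M) →
    (∀ᵐ ω ∂P, Tendsto (fun n => Xn n ω) atTop (𝓝 (X ω))) →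
    Tendsto (fun n => ρ (Xn n)) atTop (𝓝 (ρ X))

lemma exists_cont_seq {E : Type*} [TopologicalSpace E] [MeasurableSpace E] [PolishSpace E]
    [BorelSpace E] (η : Measure E) [IsFiniteMeasure η] (f : E → ℝ) (hf : Measurable f)
    (M : ℝ) (hM : ∀ x, |f x| ≤ M) :
    ∃ g : ℕ → E → ℝ, (∀ n, Continuous (g n)) ∧ (∀ n x, |g n x| ≤ M) ∧
      ∀ᵐ x ∂η, Tendsto (fun n => g n x) atTop (𝓝 (f x)) := by
  letI := TopologicalSpace.upgradeIsCompletelyMetrizable E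
  have hmem : MemLp f 1 η :=
    MemLp.of_bound hf.aestronglyMeasurable M (Eventually.of_forall hM)
  have hpos : ∀ n : ℕ, ENNReal.ofReal (1 / ((n : ℝ) + 1)) ≠ 0 := by
    intro n
    have : (0 : ℝ) < 1 / ((n : ℝ) + 1) := by positivity
    simpa using this
  choose u hu hum using fun n : ℕ =>
    hmem.exists_boundedContinuous_eLpNorm_sub_le ENNReal.one_ne_top (hpos n)
  have hlim : Tendsto (fun n => eLpNorm ((u n : E → ℝ) - f) 1 η) atTop (𝓝 0) := by
    have h0 : Tendsto (fun n : ℕ => ENNReal.ofReal (1 / ((n : ℝ) + 1))) atTop (𝓝 0) := by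
      simpa using ENNReal.tendsto_ofReal tendsto_one_div_add_atTop_nhds_zero_nat
    refine tendsto_of_tendsto_of_tendsto_of_le_of_le tendsto_const_nhds h0
      (fun _ => zero_le) (fun n => ?_)
    rw [eLpNorm_sub_comm]
    exact hu n
  have hmeas := tendstoInMeasure_of_tendsto_eLpNorm one_ne_zero
    (fun n => (hum n).aestronglyMeasurable) hf.aestronglyMeasurable hlim
  obtain ⟨ns, -, hns⟩ := hmeas.exists_seq_tendsto_ae
  refine ⟨fun n x => max (-M) (min M (u (ns n) x)), fun n => ?_, fun n x => ?_, ?_⟩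
  · exact continuous_const.max (continuous_const.min (u (ns n)).continuous)
  · have h0 : 0 ≤ M := (abs_nonneg _).trans (hM x)
    rw [abs_le]
    exact ⟨le_max_left _ _, max_le (by linarith) (min_le_left _ _)⟩
  · filter_upwards [hns] with x hx
    have h1 := (tendsto_const_nhds (x := -M)).max ((tendsto_const_nhds (x := M)).min hx)
    have h2 : max (-M) (min M (f x)) = f x := by
      have := abs_le.1 (hM x)
      rw [min_eq_right this.2, max_eq_right this.1]
    rwa [h2] at h1

lemma divergence_eq {Ω : Type*} [MeasurableSpace Ω]
    (P : Measure Ω) (ρ : (Ω → ℝ) → ℝ) (hLeb : LebesgueContinuous P ρ)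
    (E : Type*) [TopologicalSpace E] [MeasurableSpace E] [PolishSpace E] [BorelSpace E]
    (μ ν : Measure E) [IsProbabilityMeasure μ] [IsProbabilityMeasure ν] :
    divergence P ρ ν μ =
        ⨆ (f : E → ℝ) (_ : Continuous f) (_ : ∃ M : ℝ, ∀ x, |f x| ≤ M),
          ENNReal.ofReal ((∫ x, f x ∂ν) - rhoMu P ρ μ f) := by
  apply le_antisymm
  · refine iSup₂_le fun f hf => ?_
    obtain ⟨hfm, M, hM⟩ := hf
    obtain ⟨g, hgc, hgM, hg⟩ := exists_cont_seq (μ + ν) f hfm M hM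
    rw [ae_add_measure_iff] at hg
    obtain ⟨hgμ, hgν⟩ := hg
    have hint : Tendsto (fun n => ∫ x, g n x ∂ν) atTop (𝓝 (∫ x, f x ∂ν)) :=
      tendsto_integral_of_dominated_convergence (fun _ => M)
        (fun n => (hgc n).measurable.aestronglyMeasurable) (integrable_const _)
        (fun n => Eventually.of_forall (hgM n)) hgν
    have hrho : Tendsto (fun n => rhoMu P ρ μ (g n)) atTop (𝓝 (rhoMu P ρ μ f)) := by
      unfold rhoMu
      split_ifs with h
      · obtain ⟨hX, hXμ⟩ := h.choose_spec
        refine hLeb _ _ M (fun n => (hgc n).measurable.comp hX) (hfm.comp hX)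
          (fun n ω => hgM n _) ?_
        rw [← hXμ] at hgμ
        exact ae_of_ae_map hX.aemeasurable hgμ
      · exact tendsto_const_nhds
    refine le_of_tendsto' (ENNReal.tendsto_ofReal (hint.sub hrho)) fun n => ?_
    exact le_iSup_of_le (g n) (le_iSup_of_le (hgc n) (le_iSup_of_le ⟨M, hgM n⟩ le_rfl))
  · refine iSup_le fun f => iSup_le fun hf => iSup_le fun hb => ?_
    exact le_iSup₂_of_le (f := fun (f : E → ℝ) (_ : BddMeas f) =>
      ENNReal.ofReal ((∫ x, f x ∂ν) - rhoMu P ρ μ f)) f ⟨hf.measurable, hb⟩ le_rfl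

/-- If a law invariant risk measure `ρ` is Lebesgue continuous, then its induced
divergence satisfies `α(ν|μ) = sup {∫ f dν − ρ_μ(f) : f bounded continuous}` on every Polish
space; in particular `α` is simplified. -/
theorem statement6 {Ω : Type*} [MeasurableSpace Ω] [StandardBorelSpace Ω]
    (P : Measure Ω) [IsProbabilityMeasure P] [NullSingletonClass P]
    (ρ : (Ω → ℝ) → ℝ) (hρ : IsRiskMeasure P ρ) (hLI : LawInvariant P ρ)
    (hLeb : LebesgueContinuous P ρ) :
    (∀ (E : Type) [TopologicalSpace E] [MeasurableSpace E] [PolishSpace E] [BorelSpace E]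
      (μ ν : Measure E), IsProbabilityMeasure μ → IsProbabilityMeasure ν →
      divergence P ρ ν μ =
        ⨆ (f : E → ℝ) (_ : Continuous f) (_ : ∃ M : ℝ, ∀ x, |f x| ≤ M),
          ENNReal.ofReal ((∫ x, f x ∂ν) - rhoMu P ρ μ f)) ∧
    Simplified P ρ := by
  refine ⟨fun E _ _ _ _ μ ν _ _ => divergence_eq P ρ hLeb E μ ν, fun μ ν _ _ => ?_⟩
  rw [divergence_eq P ρ hLeb]
  refine iSup_congr fun f => iSup_congr fun hf => ?_
  have hb : ∃ M : ℝ, ∀ x, |f x| ≤ M := by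
    obtain ⟨M, hM⟩ := isCompact_univ.exists_bound_of_continuousOn hf.continuousOn
    exact ⟨M, fun x => hM x (Set.mem_univ x)⟩
  exact iSup_pos hb

end RiskDiv
end
end
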